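/- Under the RA model (W row-stochastic): let δ ∈ (0,1) and let t ≥ 1 be such that P(C_t^𝟘(δ)) > 0. Then P(C_{t+1}^𝟘((1−α)δ) | C_t^𝟘(δ)) > (1−δ)^N. Symmetrically, if P(C_t^𝟙(δ)) > 0, then P(C_{t+1}^𝟙((1−α)δ) | C_t^𝟙(δ)) > (1−δ)^N. (If all opinions are within δ of an extreme corner, then with conditional probability greater than (1−δ)^N they are within (1−α)δ of that corner at the next step.) -/

import Mathlib

open MeasureTheory ProbabilityTheory Filter

namespace RA

variable {Ω : Type*}

/-- History σ-algebra generated by `x 1, …, x t` and `a 1, …, a (t-1)`. -/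
def hist {N : ℕ} [MeasurableSpace Ω] (x a : ℕ → Ω → Fin N → ℝ) (t : ℕ) :
    MeasurableSpace Ω :=
  (⨆ s ∈ Finset.Icc 1 t, MeasurableSpace.comap (x s) inferInstance) ⊔
  (⨆ s ∈ Finset.Ico 1 t, MeasurableSpace.comap (a s) inferInstance)

/-- The Random Actions (RA) opinion dynamics model. -/
structure IsRAModel {N : ℕ} [MeasurableSpace Ω] (μ : Measure Ω) (α : ℝ)
    (W : Matrix (Fin N) (Fin N) ℝ) (x a : ℕ → Ω → Fin N → ℝ) : Prop where
  isProb : IsProbabilityMeasure μ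
  alpha_mem : α ∈ Set.Ioo (0 : ℝ) 1
  W_nonneg : ∀ i j, 0 ≤ W i j
  W_rowsum : ∀ i, ∑ j, W i j = 1
  x_meas : ∀ t, Measurable (x t)
  a_meas : ∀ t, Measurable (a t)
  x_mem : ∀ t, 1 ≤ t → ∀ ω i, x t ω i ∈ Set.Icc (0 : ℝ) 1
  a_mem : ∀ t, 1 ≤ t → ∀ ω i, a t ω i = 0 ∨ a t ω i = 1
  update : ∀ t, 1 ≤ t → ∀ ω i,
    x (t + 1) ω i = (1 - α) * x t ω i + α * ∑ j, W i j * a t ω j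
  bernoulli : ∀ t, 1 ≤ t → ∀ b : Fin N → Bool, ∀ H : Set Ω,
    MeasurableSet[hist x a t] H →
    (μ (H ∩ {ω | ∀ i, a t ω i = if b i then (1 : ℝ) else 0})).toReal
      = ∫ ω in H, ∏ i, (if b i then x t ω i else 1 - x t ω i) ∂μ

/-- `W` is irreducible: the network is strongly connected. -/
def Irreducible {N : ℕ} (W : Matrix (Fin N) (Fin N) ℝ) : Prop :=
  ∀ i j, ∃ n : ℕ, 0 < (W ^ n) i j

/-- The event that `x t i ∈ [0,δ) ∪ (1-δ,1]`. -/
def cti {N : ℕ} (x : ℕ → Ω → Fin N → ℝ) (δ : ℝ) (t : ℕ) (i : Fin N) : Set Ω :=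
  {ω | x t ω i < δ ∨ 1 - δ < x t ω i}

def ct {N : ℕ} (x : ℕ → Ω → Fin N → ℝ) (δ : ℝ) (t : ℕ) : Set Ω :=
  ⋂ i, cti x δ t i

def c0 {N : ℕ} (x : ℕ → Ω → Fin N → ℝ) (δ : ℝ) (t : ℕ) (i : Fin N) : Set Ω :=
  {ω | x t ω i < δ}

def c1 {N : ℕ} (x : ℕ → Ω → Fin N → ℝ) (δ : ℝ) (t : ℕ) (i : Fin N) : Set Ω :=
  {ω | 1 - δ < x t ω i}

/-- The event that every coordinate of `x t` is within `δ` of `0`. -/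
def corner0 {N : ℕ} (x : ℕ → Ω → Fin N → ℝ) (δ : ℝ) (t : ℕ) : Set Ω :=
  {ω | ∀ i, x t ω i < δ}

/-- The event that every coordinate of `x t` is within `δ` of `1`. -/
def corner1 {N : ℕ} (x : ℕ → Ω → Fin N → ℝ) (δ : ℝ) (t : ℕ) : Set Ω :=
  {ω | ∀ i, 1 - δ < x t ω i}

/-- Agents `i` and `j` communicate. -/
def Communicates {N : ℕ} (W : Matrix (Fin N) (Fin N) ℝ) (i j : Fin N) : Prop :=
  (∃ n : ℕ, 0 < (W ^ n) j i) ∧ (∃ n : ℕ, 0 < (W ^ n) i j)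

/-- `C` is a communication class (strongly connected component). -/
def CommClass {N : ℕ} (W : Matrix (Fin N) (Fin N) ℝ) (C : Set (Fin N)) : Prop :=
  ∃ i, C = {j | Communicates W i j}

/-- `C` is a maximal communication class: no agent outside `C` has a directed
path into `C`. -/
def IsMaximalClass {N : ℕ} (W : Matrix (Fin N) (Fin N) ℝ) (C : Set (Fin N)) : Prop :=
  CommClass W C ∧ ∀ i ∈ C, ∀ j, (∃ n : ℕ, 0 < (W ^ n) i j) → j ∈ C

theorem measurable_hist {N : ℕ} [MeasurableSpace Ω] (x a : ℕ → Ω → Fin N → ℝ) {t : ℕ}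
    (ht : 1 ≤ t) : Measurable[hist x a t] (x t) := by
  have h : MeasurableSpace.comap (x t) inferInstance ≤ hist x a t :=
    le_sup_of_le_left (le_iSup₂_of_le t (Finset.mem_Icc.2 ⟨ht, le_rfl⟩) le_rfl)
  exact Measurable.mono (comap_measurable (x t)) h le_rfl

/-- If on a history event `H` the conditional probability of the action profile `b` exceeds `c`,
and `b` leads from `H` into `E`, then `E` has conditional probability more than `c` given `H`. -/
theorem IsRAModel.lt_cond_of_forall_lt_prod {N : ℕ} [MeasurableSpace Ω] {μ : Measure Ω} {α : ℝ}
    {W : Matrix (Fin N) (Fin N) ℝ} {x a : ℕ → Ω → Fin N → ℝ} (hRA : IsRAModel μ α W x a)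
    {t : ℕ} (ht : 1 ≤ t) (b : Fin N → Bool) {H E : Set Ω} {c : ℝ} {S : Set (Fin N → ℝ)}
    (hS : MeasurableSet S) (hHS : H = x t ⁻¹' S) (hH : μ H ≠ 0)
    (hc : ∀ ω ∈ H, c < ∏ i, (if b i then x t ω i else 1 - x t ω i))
    (hE : H ∩ {ω | ∀ i, a t ω i = if b i then (1 : ℝ) else 0} ⊆ E) :
    c < ((μ[|H]) E).toReal := by
  have := hRA.isProb
  have hmeas : MeasurableSet H := hHS ▸ hRA.x_meas t hS
  have hb := hRA.bernoulli t ht b H (hHS ▸ measurable_hist x a ht hS)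
  set f : Ω → ℝ := fun ω => ∏ i, (if b i then x t ω i else 1 - x t ω i) with hf
  have hfm : Measurable f := by
    refine Finset.measurable_prod _ fun i _ => ?_
    have hi : Measurable fun ω => x t ω i := (measurable_pi_apply i).comp (hRA.x_meas t)
    split_ifs
    · exact hi
    · exact measurable_const.sub hi
  have hfi : Integrable f μ := by
    refine Integrable.of_bound hfm.aestronglyMeasurable 1 (ae_of_all _ fun ω => ?_)
    rw [hf, Real.norm_eq_abs, Finset.abs_prod]
    refine Finset.prod_le_one (fun i _ => abs_nonneg _) fun i _ => ?_
    obtain ⟨h0, h1⟩ := hRA.x_mem t ht ω i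
    split_ifs <;> exact abs_le.2 ⟨by linarith, by linarith⟩
  have hpos : 0 < ∫ ω in H, (f ω - c) ∂μ := by
    refine (setIntegral_pos_iff_support_of_nonneg_ae ?_
      (hfi.sub (integrable_const c)).integrableOn).2 ?_
    · exact (ae_restrict_iff' hmeas).2 (ae_of_all _ fun ω hω => (sub_pos.2 (hc ω hω)).le)
    · have hsub : H ⊆ Function.support (f - fun _ => c) :=
        fun ω hω => Function.mem_support.2 (sub_pos.2 (hc ω hω)).ne'
      rw [Set.inter_eq_right.2 hsub]
      exact pos_iff_ne_zero.2 hH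
  rw [integral_sub hfi.integrableOn (integrable_const c), setIntegral_const, smul_eq_mul,
    ← hb] at hpos
  have hHpos : 0 < (μ H).toReal := ENNReal.toReal_pos hH (measure_ne_top _ _)
  rw [cond_apply hmeas, ENNReal.toReal_mul, ENNReal.toReal_inv, inv_mul_eq_div, lt_div_iff₀ hHpos]
  have hle := ENNReal.toReal_mono (measure_ne_top μ _)
    (measure_mono (μ := μ) (Set.subset_inter Set.inter_subset_left hE))
  rw [Measure.real] at hpos
  linarith

theorem conditional_corner_contraction {Ω : Type*} [MeasurableSpace Ω] {N : ℕ} (hN : 1 ≤ N)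
    (μ : Measure Ω) (α : ℝ) (W : Matrix (Fin N) (Fin N) ℝ)
    (x a : ℕ → Ω → Fin N → ℝ) (hRA : IsRAModel μ α W x a) :
    ∀ δ ∈ Set.Ioo (0 : ℝ) 1, ∀ t : ℕ, 1 ≤ t →
      (μ (corner0 x δ t) ≠ 0 →
        ((μ[|corner0 x δ t]) (corner0 x ((1 - α) * δ) (t + 1))).toReal
          > (1 - δ) ^ N)
      ∧ (μ (corner1 x δ t) ≠ 0 →
        ((μ[|corner1 x δ t]) (corner1 x ((1 - α) * δ) (t + 1))).toReal
          > (1 - δ) ^ N) := by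
  intro δ ⟨hδ0, hδ1⟩ t ht
  have hα := hRA.alpha_mem
  have : Nonempty (Fin N) := ⟨⟨0, hN⟩⟩
  have hpow : (1 - δ) ^ N = ∏ _i : Fin N, (1 - δ) := by simp
  refine ⟨fun h => ?_, fun h => ?_⟩
  · refine hRA.lt_cond_of_forall_lt_prod ht (fun _ => false) (S := {y | ∀ i, y i < δ})
      ?_ rfl h ?_ ?_
    · simp only [Set.ofPred_forall]
      exact .iInter fun i => measurableSet_lt (measurable_pi_apply i) measurable_const
    · intro ω hω
      rw [hpow]
      refine Finset.prod_lt_prod_of_nonempty (fun i _ => by linarith) (fun i _ => ?_)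
        Finset.univ_nonempty
      simpa using hω i
    · rintro ω ⟨hω, ha⟩ i
      have hi := mul_lt_mul_of_pos_left (hω i) (sub_pos.2 hα.2)
      simp only [Bool.false_eq_true, if_false, Set.mem_ofPred_eq] at ha
      rw [hRA.update t ht]
      simpa [ha] using hi
  · refine hRA.lt_cond_of_forall_lt_prod ht (fun _ => true) (S := {y | ∀ i, 1 - δ < y i})
      ?_ rfl h ?_ ?_
    · simp only [Set.ofPred_forall]
      exact .iInter fun i => measurableSet_lt measurable_const (measurable_pi_apply i)
    · intro ω hω
      rw [hpow]
      refine Finset.prod_lt_prod_of_nonempty (fun i _ => by linarith) (fun i _ => ?_)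
        Finset.univ_nonempty
      simpa using hω i
    · rintro ω ⟨hω, ha⟩ i
      have hi := mul_lt_mul_of_pos_left (hω i) (sub_pos.2 hα.2)
      simp only [if_true, Set.mem_ofPred_eq] at ha
      rw [hRA.update t ht]
      simp only [ha, mul_one, hRA.W_rowsum]
      linarith

end RA
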